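/- Let X_1,…,X_K be mutually independent finitely-valued random variables and let (X_1,…,X_K,Y,Z) be jointly distributed. Suppose 𝒦′* ⊆ 𝒦 attains max_{𝒦′⊆𝒦} [ I(X_{𝒦′};Y|X_{𝒦∖𝒦′}) − I(X_{𝒦′};Z|X_{𝒦∖𝒦′}) ]⁺ and that I(X_{𝒦′*};Y|X_{𝒦∖𝒦′*}) − I(X_{𝒦′*};Z|X_{𝒦∖𝒦′*}) > 0. Then for every proper subset S ⊊ 𝒦′*, I(X_S;Y|X_{𝒦∖S}) − I(X_S;Z|X_{𝒦∖𝒦′*}) ≥ 0. -/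

import Mathlib

open scoped Classical

noncomputable section

/-- Probability that random variable `X` takes value `x`, under pmf `p` on a finite sample space. -/
def probOf {Ω α : Type} [Fintype Ω] (p : Ω → ℝ) (X : Ω → α) (x : α) : ℝ :=
  ∑ ω, if X ω = x then p ω else 0

/-- Shannon entropy of a finitely-valued random variable. -/
def Hent {Ω α : Type} [Fintype Ω] [Fintype α] (p : Ω → ℝ) (X : Ω → α) : ℝ :=
  -∑ x, probOf p X x * Real.log (probOf p X x)

/-- Conditional entropy `H(X | C)`. -/
def condHent {Ω α γ : Type} [Fintype Ω] [Fintype α] [Fintype γ]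
    (p : Ω → ℝ) (X : Ω → α) (C : Ω → γ) : ℝ :=
  Hent p (fun ω => (X ω, C ω)) - Hent p C

/-- Conditional mutual information `I(A;B | C)`. -/
def IcondMut {Ω α β γ : Type} [Fintype Ω] [Fintype α] [Fintype β] [Fintype γ]
    (p : Ω → ℝ) (A : Ω → α) (B : Ω → β) (C : Ω → γ) : ℝ :=
  condHent p A C + condHent p B C - condHent p (fun ω => (A ω, B ω)) C

/-- Mutual information `I(A;B)`. -/
def Imut {Ω α β : Type} [Fintype Ω] [Fintype α] [Fintype β]
    (p : Ω → ℝ) (A : Ω → α) (B : Ω → β) : ℝ :=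
  Hent p A + Hent p B - Hent p (fun ω => (A ω, B ω))

/-- `p` is a probability mass function. -/
def IsPMF {Ω : Type} [Fintype Ω] (p : Ω → ℝ) : Prop :=
  (∀ ω, 0 ≤ p ω) ∧ ∑ ω, p ω = 1

/-- The tuple `X_S = (X_k)_{k ∈ S}` as a random variable. -/
def tup {Ω ι : Type} {𝒳 : ι → Type} (X : ∀ k, Ω → 𝒳 k) (S : Finset ι) :
    Ω → ∀ k : S, 𝒳 k.1 :=
  fun ω k => X k.1 ω

/-- The random variables `X_1, …, X_K` are mutually independent. -/
def MutIndep {Ω ι : Type} [Fintype Ω] [Fintype ι] {𝒳 : ι → Type} [∀ k, Fintype (𝒳 k)]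
    (p : Ω → ℝ) (X : ∀ k, Ω → 𝒳 k) : Prop :=
  ∀ x : ∀ k, 𝒳 k, probOf p (fun ω k => X k ω) x = ∏ k, probOf p (X k) (x k)

/-- Expectation of a function of `X`, as a sum over outcomes or over the values of `X`. -/
theorem sum_mul_comp_eq_sum_probOf {Ω α : Type} [Fintype Ω] [Fintype α] (p : Ω → ℝ)
    (X : Ω → α) (g : α → ℝ) : ∑ ω, p ω * g (X ω) = ∑ x, probOf p X x * g x := by
  simp only [probOf, Finset.sum_mul, ite_mul, zero_mul]
  rw [Finset.sum_comm]
  simp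

theorem Hent_eq_neg_sum {Ω α : Type} [Fintype Ω] [Fintype α] (p : Ω → ℝ) (X : Ω → α) :
    Hent p X = -∑ ω, p ω * Real.log (probOf p X (X ω)) := by
  rw [Hent, sum_mul_comp_eq_sum_probOf p X fun x => Real.log (probOf p X x)]

/-- Entropy depends only on the partition of the sample space induced by the random variable. -/
theorem Hent_congr {Ω α β : Type} [Fintype Ω] [Fintype α] [Fintype β] (p : Ω → ℝ)
    (X : Ω → α) (Y : Ω → β) (h : ∀ ω ω', X ω = X ω' ↔ Y ω = Y ω') : Hent p X = Hent p Y := by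
  simp only [Hent_eq_neg_sum, probOf, h]

theorem probOf_nonneg {Ω α : Type} [Fintype Ω] {p : Ω → ℝ} (hp : ∀ ω, 0 ≤ p ω)
    (X : Ω → α) (x : α) : 0 ≤ probOf p X x :=
  Finset.sum_nonneg fun ω _ => by split_ifs <;> simp [hp ω]

theorem probOf_self_pos {Ω α : Type} [Fintype Ω] {p : Ω → ℝ} (hp : ∀ ω, 0 ≤ p ω)
    (X : Ω → α) {ω : Ω} (hω : 0 < p ω) : 0 < probOf p X (X ω) :=
  Finset.sum_pos' (fun ω' _ => by split_ifs <;> simp [hp ω']) ⟨ω, Finset.mem_univ _, by simpa⟩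

theorem sum_probOf_prod {Ω α γ : Type} [Fintype Ω] [Fintype α] (p : Ω → ℝ)
    (A : Ω → α) (C : Ω → γ) (c : γ) :
    ∑ a, probOf p (fun ω => (A ω, C ω)) (a, c) = probOf p C c := by
  simp only [probOf, Prod.mk.injEq, ite_and]
  rw [Finset.sum_comm]
  simp

theorem sum_probOf {Ω α : Type} [Fintype Ω] [Fintype α] (p : Ω → ℝ) (X : Ω → α) :
    ∑ x, probOf p X x = ∑ ω, p ω := by
  simpa using (sum_mul_comp_eq_sum_probOf p X fun _ => 1).symm

/-- Strong subadditivity of entropy. -/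
theorem Hent_submodular {Ω α β γ : Type} [Fintype Ω] [Fintype α] [Fintype β] [Fintype γ]
    {p : Ω → ℝ} (hp : IsPMF p) (A : Ω → α) (B : Ω → β) (C : Ω → γ) :
    Hent p (fun ω => (A ω, B ω, C ω)) + Hent p C ≤
      Hent p (fun ω => (A ω, C ω)) + Hent p (fun ω => (B ω, C ω)) := by
  obtain ⟨h0, h1⟩ := hp
  set pac := probOf p fun ω => (A ω, C ω) with hpac
  set pbc := probOf p fun ω => (B ω, C ω) with hpbc
  set pabc := probOf p fun ω => (A ω, B ω, C ω) with hpabc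
  let r : α × β × γ → ℝ := fun x =>
    pac (x.1, x.2.2) * pbc (x.2.1, x.2.2) / (pabc x * probOf p C x.2.2)
  have hmass : ∑ ω, p ω * r (A ω, B ω, C ω) ≤ 1 := by
    rw [sum_mul_comp_eq_sum_probOf p (fun ω => (A ω, B ω, C ω)) r]
    calc ∑ x, pabc x * r x
        ≤ ∑ x : α × β × γ, pac (x.1, x.2.2) * pbc (x.2.1, x.2.2) / probOf p C x.2.2 := by
          refine Finset.sum_le_sum fun x _ => ?_
          have hnn : 0 ≤ pac (x.1, x.2.2) * pbc (x.2.1, x.2.2) / probOf p C x.2.2 :=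
            div_nonneg (mul_nonneg (probOf_nonneg h0 _ _) (probOf_nonneg h0 _ _))
              (probOf_nonneg h0 _ _)
          by_cases hx : pabc x = 0
          · simpa [hx] using hnn
          · refine le_of_eq ?_
            simp only [r]
            rw [mul_div_assoc', mul_div_mul_left _ _ hx]
      _ = ∑ c, probOf p C c := by
          simp only [Fintype.sum_prod_type]
          rw [Finset.sum_congr rfl fun a _ => Finset.sum_comm, Finset.sum_comm]
          refine Finset.sum_congr rfl fun c _ => ?_
          simp only [← Finset.sum_div, ← Finset.mul_sum, ← Finset.sum_mul, hpac, hpbc,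
            sum_probOf_prod, mul_self_div_self]
      _ = 1 := by rw [sum_probOf, h1]
  have hlog : ∑ ω, p ω * (Real.log (pac (A ω, C ω)) + Real.log (pbc (B ω, C ω))
      - Real.log (pabc (A ω, B ω, C ω)) - Real.log (probOf p C (C ω)))
      ≤ ∑ ω, p ω * (r (A ω, B ω, C ω) - 1) := by
    refine Finset.sum_le_sum fun ω _ => ?_
    rcases (h0 ω).eq_or_lt with hω | hω
    · simp [← hω]
    refine mul_le_mul_of_nonneg_left ?_ hω.le
    have hac : 0 < pac (A ω, C ω) := probOf_self_pos h0 (fun ω => (A ω, C ω)) hω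
    have hbc : 0 < pbc (B ω, C ω) := probOf_self_pos h0 (fun ω => (B ω, C ω)) hω
    have habc : 0 < pabc (A ω, B ω, C ω) := probOf_self_pos h0 (fun ω => (A ω, B ω, C ω)) hω
    have hc : 0 < probOf p C (C ω) := probOf_self_pos h0 C hω
    have := Real.log_le_sub_one_of_pos (div_pos (mul_pos hac hbc) (mul_pos habc hc))
    rw [Real.log_div (by positivity) (by positivity), Real.log_mul hac.ne' hbc.ne',
      Real.log_mul habc.ne' hc.ne'] at this
    simp only [r]
    linarith
  simp only [mul_sub, mul_add, Finset.sum_sub_distrib, Finset.sum_add_distrib, mul_one, h1]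
    at hlog
  simp only [Hent_eq_neg_sum]
  linarith

theorem Hent_of_forall_eq {Ω α : Type} [Fintype Ω] [Fintype α] {p : Ω → ℝ} (hp : IsPMF p)
    {X : Ω → α} (h : ∀ ω ω', X ω = X ω') : Hent p X = 0 := by
  have hX : ∀ ω, probOf p X (X ω) = 1 := fun ω => by
    rw [← hp.2]
    exact Finset.sum_congr rfl fun ω' _ => if_pos (h ω' ω)
  simp [Hent_eq_neg_sum, hX]

theorem Hent_prod_le {Ω α β : Type} [Fintype Ω] [Fintype α] [Fintype β] {p : Ω → ℝ}
    (hp : IsPMF p) (A : Ω → α) (B : Ω → β) :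
    Hent p (fun ω => (A ω, B ω)) ≤ Hent p A + Hent p B := by
  have h := Hent_submodular hp A B fun _ => ()
  rw [Hent_of_forall_eq hp (X := fun _ => ()) fun _ _ => rfl,
    Hent_congr p (fun ω => (A ω, B ω, ())) (fun ω => (A ω, B ω)) (by simp),
    Hent_congr p (fun ω => (A ω, ())) A (by simp),
    Hent_congr p (fun ω => (B ω, ())) B (by simp)] at h
  linarith

theorem sdiff_inter_union_sdiff {ι : Type} [DecidableEq ι] {S T : Finset ι} (h : S ⊆ T)
    (U : Finset ι) : (U \ S) ∩ (S ∪ U \ T) = U \ T := by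
  ext k
  have := @h k
  simp only [Finset.mem_inter, Finset.mem_union, Finset.mem_sdiff]
  tauto

theorem tup_eq_iff {Ω ι : Type} {𝒳 : ι → Type} (X : ∀ k, Ω → 𝒳 k) (S : Finset ι)
    (ω ω' : Ω) :
    tup X S ω = tup X S ω' ↔ ∀ k ∈ S, X k ω = X k ω' := by
  simp [tup, funext_iff]

section Tuples

variable {Ω ι : Type} [Fintype Ω] [DecidableEq ι] {𝒳 : ι → Type} [∀ k, Fintype (𝒳 k)] {p : Ω → ℝ}

theorem Hent_tup_union_le (hp : IsPMF p) (X : ∀ k, Ω → 𝒳 k) (S T : Finset ι) :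
    Hent p (tup X (S ∪ T)) ≤ Hent p (tup X S) + Hent p (tup X T) := by
  rw [Hent_congr p (tup X (S ∪ T)) (fun ω => (tup X S ω, tup X T ω))
    (by intros; simp only [Prod.mk.injEq, tup_eq_iff, Finset.mem_union]; grind)]
  exact Hent_prod_le hp _ _

theorem Hent_tup_le_sum (hp : IsPMF p) (X : ∀ k, Ω → 𝒳 k) (S : Finset ι) :
    Hent p (tup X S) ≤ ∑ k ∈ S, Hent p (X k) := by
  induction S using Finset.induction_on with
  | empty => simp [Hent_of_forall_eq hp (X := tup X ∅) (by simp [tup_eq_iff])]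
  | insert k S hk ih =>
    have h := Hent_tup_union_le hp X {k} S
    rw [Hent_congr p (tup X {k}) (X k) (by simp [tup_eq_iff])] at h
    rw [Finset.sum_insert hk, Finset.insert_eq]
    linarith

theorem Hent_tup_univ_eq_sum [Fintype ι] (hp : IsPMF p) {X : ∀ k, Ω → 𝒳 k}
    (hX : MutIndep p X) : Hent p (tup X Finset.univ) = ∑ k, Hent p (X k) := by
  rw [Hent_congr p _ (fun ω k => X k ω) (by intros; rw [tup_eq_iff]; simp [funext_iff])]
  simp only [Hent_eq_neg_sum, Finset.sum_neg_distrib]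
  rw [Finset.sum_comm]
  refine congrArg _ (Finset.sum_congr rfl fun ω _ => ?_)
  rcases (hp.1 ω).eq_or_lt with hω | hω
  · simp [← hω]
  rw [hX, Real.log_prod fun k _ => (probOf_self_pos hp.1 (X k) hω).ne', Finset.mul_sum]

theorem Hent_tup_eq_sum [Fintype ι] (hp : IsPMF p) {X : ∀ k, Ω → 𝒳 k}
    (hX : MutIndep p X) (S : Finset ι) : Hent p (tup X S) = ∑ k ∈ S, Hent p (X k) := by
  have h1 := Hent_tup_union_le hp X S Sᶜ
  rw [Finset.union_compl, Hent_tup_univ_eq_sum hp hX, ← Finset.sum_add_sum_compl S] at h1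
  linarith [Hent_tup_le_sum hp X S, Hent_tup_le_sum hp X Sᶜ]

theorem IcondMut_tup {𝒴 : Type} [Fintype 𝒴] (X : ∀ k, Ω → 𝒳 k) (Y : Ω → 𝒴)
    {S C U : Finset ι} (hU : S ∪ C = U) :
    IcondMut p (tup X S) Y (tup X C) = Hent p (tup X U) + Hent p (fun ω => (Y ω, tup X C ω))
      - Hent p (fun ω => (Y ω, tup X U ω)) - Hent p (tup X C) := by
  subst hU
  rw [IcondMut, condHent, condHent, condHent,
    Hent_congr p (fun ω => (tup X S ω, tup X C ω)) (tup X (S ∪ C))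
      (by intros; simp only [Prod.mk.injEq, tup_eq_iff, Finset.mem_union]; grind),
    Hent_congr p (fun ω => ((tup X S ω, Y ω), tup X C ω)) (fun ω => (Y ω, tup X (S ∪ C) ω))
      (by intros; simp only [Prod.mk.injEq, tup_eq_iff, Finset.mem_union]; grind)]
  ring

theorem Hent_pair_tup_submodular {𝒴 : Type} [Fintype 𝒴] (hp : IsPMF p) (X : ∀ k, Ω → 𝒳 k)
    (Y : Ω → 𝒴) (S T : Finset ι) :
    Hent p (fun ω => (Y ω, tup X (S ∪ T) ω)) + Hent p (fun ω => (Y ω, tup X (S ∩ T) ω)) ≤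
      Hent p (fun ω => (Y ω, tup X S ω)) + Hent p (fun ω => (Y ω, tup X T ω)) := by
  have h := Hent_submodular hp (tup X S) (tup X T) fun ω => (Y ω, tup X (S ∩ T) ω)
  rwa [Hent_congr p (fun ω => (tup X S ω, tup X T ω, Y ω, tup X (S ∩ T) ω))
      (fun ω => (Y ω, tup X (S ∪ T) ω))
      (by
        intros
        simp only [Prod.mk.injEq, tup_eq_iff, Finset.mem_union, Finset.mem_inter]
        grind),
    Hent_congr p (fun ω => (tup X S ω, Y ω, tup X (S ∩ T) ω)) (fun ω => (Y ω, tup X S ω))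
      (by intros; simp only [Prod.mk.injEq, tup_eq_iff, Finset.mem_inter]; grind),
    Hent_congr p (fun ω => (tup X T ω, Y ω, tup X (S ∩ T) ω)) (fun ω => (Y ω, tup X T ω))
      (by intros; simp only [Prod.mk.injEq, tup_eq_iff, Finset.mem_inter]; grind)] at h

end Tuples


theorem stmt11 {K : ℕ} (hK : 1 ≤ K) {Ω : Type} [Fintype Ω]
    {𝒳 : Fin K → Type} [∀ k, Fintype (𝒳 k)] {𝒴 𝒵 : Type} [Fintype 𝒴] [Fintype 𝒵]
    (p : Ω → ℝ) (hp : IsPMF p)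
    (X : ∀ k, Ω → 𝒳 k) (Y : Ω → 𝒴) (Z : Ω → 𝒵) (hind : MutIndep p X)
    (K'star : Finset (Fin K))
    (hmax : ∀ K' : Finset (Fin K),
      max 0 (IcondMut p (tup X K') Y (tup X (Finset.univ \ K')) -
              IcondMut p (tup X K') Z (tup X (Finset.univ \ K'))) ≤
        max 0 (IcondMut p (tup X K'star) Y (tup X (Finset.univ \ K'star)) -
              IcondMut p (tup X K'star) Z (tup X (Finset.univ \ K'star))))
    (hpos : 0 < IcondMut p (tup X K'star) Y (tup X (Finset.univ \ K'star)) -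
              IcondMut p (tup X K'star) Z (tup X (Finset.univ \ K'star))) :
    ∀ S ⊂ K'star,
      0 ≤ IcondMut p (tup X S) Y (tup X (Finset.univ \ S)) -
            IcondMut p (tup X S) Z (tup X (Finset.univ \ K'star)) := by
  intro S hS
  have hsub := hS.subset
  have hle := (le_max_right _ _).trans ((hmax (K'star \ S)).trans_eq (max_eq_right hpos.le))
  have hcompl : Finset.univ \ (K'star \ S) = S ∪ Finset.univ \ K'star := by grind
  have huniv (T : Finset (Fin K)) : T ∪ Finset.univ \ T = Finset.univ :=
    Finset.union_sdiff_of_subset (Finset.subset_univ T)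
  rw [hcompl] at hle
  have hfull : K'star \ S ∪ (S ∪ Finset.univ \ K'star) = Finset.univ := by grind
  simp only [IcondMut_tup X _ hfull, IcondMut_tup X _ (huniv _)] at hle
  rw [IcondMut_tup X Y (huniv S), IcondMut_tup X Z rfl]
  have hsm := Hent_pair_tup_submodular hp X Y (Finset.univ \ S) (S ∪ Finset.univ \ K'star)
  have hunion : Finset.univ \ S ∪ (S ∪ Finset.univ \ K'star) = Finset.univ := by grind
  have hinter : (Finset.univ \ S) ∩ (S ∪ Finset.univ \ K'star) = Finset.univ \ K'star :=
    sdiff_inter_union_sdiff hsub _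
  have hmod := Finset.sum_union_inter (s₁ := Finset.univ \ S)
    (s₂ := S ∪ Finset.univ \ K'star) (f := fun k => Hent p (X k))
  rw [hunion, hinter] at hsm hmod
  simp only [← Hent_tup_eq_sum hp hind] at hmod
  linarith
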